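/- Under the standing assumptions, η·C₁ ≤ C and (1−η)·C₂ ≤ C, where C_k is the capacity of the component channel W_k. -/

import Mathlib

open Finset

noncomputable section

variable {𝒳 𝒴 : Type*} [Fintype 𝒳] [Fintype 𝒴]

/-- `P` is a probability distribution on the finite alphabet `𝒳`. -/
def IsDist (P : 𝒳 → ℝ) : Prop := (∀ x, 0 ≤ P x) ∧ ∑ x, P x = 1

/-- The output distribution `PW` induced by input distribution `P` and channel `W`. -/
def outDist (P : 𝒳 → ℝ) (W : 𝒳 → 𝒴 → ℝ) (y : 𝒴) : ℝ := ∑ x, P x * W x y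

/-- The mutual information `I(P, W)` (natural logarithm). -/
def mutInfo (P : 𝒳 → ℝ) (W : 𝒳 → 𝒴 → ℝ) : ℝ :=
  ∑ x, ∑ y, P x * W x y * Real.log (W x y / outDist P W y)

/-- Relative entropy (KL divergence) between two pmfs on a finite alphabet. -/
def relEnt (p q : 𝒴 → ℝ) : ℝ := ∑ y, p y * Real.log (p y / q y)

/-- Directional derivative `∇I_k(v)` of the mutual information at `P*` along `v`. -/
def gradI (Pstar : 𝒳 → ℝ) (W : 𝒳 → 𝒴 → ℝ) (v : 𝒳 → ℝ) : ℝ :=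
  ∑ x, v x * relEnt (W x) (outDist Pstar W)


section ChannelInequalities

variable {W : 𝒳 → 𝒴 → ℝ} {P R : 𝒳 → ℝ}

theorem relEnt_nonneg {p q : 𝒴 → ℝ} (hp : ∀ y, 0 ≤ p y) (hq : ∀ y, 0 ≤ q y)
    (hac : ∀ y, q y = 0 → p y = 0) (hsum : ∑ y, q y ≤ ∑ y, p y) : 0 ≤ relEnt p q := by
  have key : ∀ y, p y - q y ≤ p y * Real.log (p y / q y) := by
    intro y
    rcases (hp y).eq_or_lt with h | h
    · simp [← h, hq y]
    · have hqy : 0 < q y := (hq y).lt_of_ne fun h0 => h.ne' (hac y h0.symm)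
      have h1 := Real.one_sub_inv_le_log_of_pos (div_pos h hqy)
      have h2 := mul_le_mul_of_nonneg_left h1 h.le
      have h3 : p y * (1 - (p y / q y)⁻¹) = p y - q y := by field_simp
      linarith
  have := Finset.sum_le_sum fun y (_ : y ∈ Finset.univ) => key y
  rw [Finset.sum_sub_distrib] at this
  unfold relEnt
  linarith

theorem outDist_nonneg {β : Type*} {W : 𝒳 → β → ℝ} (hP : ∀ x, 0 ≤ P x)
    (hW : ∀ x y, 0 ≤ W x y) (y : β) : 0 ≤ outDist P W y :=
  Finset.sum_nonneg fun x _ => mul_nonneg (hP x) (hW x y)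

theorem mul_eq_zero_of_outDist_eq_zero {β : Type*} {W : 𝒳 → β → ℝ}
    (hP : ∀ x, 0 ≤ P x) (hW : ∀ x y, 0 ≤ W x y) {y : β}
    (h : outDist P W y = 0) (x : 𝒳) : P x * W x y = 0 :=
  (Finset.sum_eq_zero_iff_of_nonneg fun x _ => mul_nonneg (hP x) (hW x y)).1 h x
    (Finset.mem_univ x)

theorem sum_outDist (hP : IsDist P) (hWsum : ∀ x, ∑ y, W x y = 1) :
    ∑ y, outDist P W y = 1 := by
  unfold outDist
  rw [Finset.sum_comm]
  simp [← Finset.mul_sum, hWsum, hP.2]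

theorem mutInfo_eq_sum_relEnt (P : 𝒳 → ℝ) (W : 𝒳 → 𝒴 → ℝ) :
    mutInfo P W = ∑ x, P x * relEnt (W x) (outDist P W) := by
  simp only [mutInfo, relEnt, Finset.mul_sum, mul_assoc]

/-- The compensation identity for the mutual information. -/
theorem sum_relEnt_eq_mutInfo_add_relEnt {q : 𝒴 → ℝ} (hP : ∀ x, 0 ≤ P x)
    (hW : ∀ x y, 0 ≤ W x y) (hac : ∀ x y, q y = 0 → P x * W x y = 0) :
    ∑ x, P x * relEnt (W x) q = mutInfo P W + relEnt (outDist P W) q := by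
  have h : relEnt (outDist P W) q
      = ∑ x, ∑ y, P x * W x y * Real.log (outDist P W y / q y) := by
    rw [Finset.sum_comm]
    simp only [relEnt, ← Finset.sum_mul]
    rfl
  rw [h]
  simp only [mutInfo, relEnt, Finset.mul_sum, ← Finset.sum_add_distrib]
  refine Finset.sum_congr rfl fun x _ => Finset.sum_congr rfl fun y _ => ?_
  rw [← mul_assoc, ← mul_add]
  by_cases h0 : P x * W x y = 0
  · simp [h0]
  · have hq : q y ≠ 0 := fun hq => h0 (hac x y hq)
    have ho : outDist P W y ≠ 0 := fun ho => h0 (mul_eq_zero_of_outDist_eq_zero hP hW ho x)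
    have hw : W x y ≠ 0 := right_ne_zero_of_mul h0
    rw [Real.log_div hw hq, Real.log_div hw ho, Real.log_div ho hq]
    ring

theorem mutInfo_le_sum_relEnt {q : 𝒴 → ℝ} (hP : IsDist P)
    (hW : ∀ x y, 0 ≤ W x y) (hWsum : ∀ x, ∑ y, W x y = 1) (hq : ∀ y, 0 ≤ q y)
    (hqsum : ∑ y, q y = 1) (hac : ∀ x y, q y = 0 → P x * W x y = 0) :
    mutInfo P W ≤ ∑ x, P x * relEnt (W x) q := by
  have h : 0 ≤ relEnt (outDist P W) q :=
    relEnt_nonneg (outDist_nonneg hP.1 hW) hq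
      (fun y hy => Finset.sum_eq_zero fun x _ => hac x y hy)
      (hqsum.trans (sum_outDist hP hWsum).symm).le
  rw [sum_relEnt_eq_mutInfo_add_relEnt hP.1 hW hac]
  linarith

theorem IsDist.mix (hP : IsDist P) (hR : IsDist R) {a b : ℝ} (ha : 0 ≤ a) (hb : 0 ≤ b)
    (hab : a + b = 1) : IsDist fun x => a * P x + b * R x := by
  refine ⟨fun x => add_nonneg (mul_nonneg ha (hP.1 x)) (mul_nonneg hb (hR.1 x)), ?_⟩
  rw [Finset.sum_add_distrib, ← Finset.mul_sum, ← Finset.mul_sum, hP.2, hR.2]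
  linarith

/-- The mutual information is concave in the input distribution. -/
theorem mutInfo_mix_ge (hP : IsDist P) (hR : IsDist R) (hW : ∀ x y, 0 ≤ W x y)
    (hWsum : ∀ x, ∑ y, W x y = 1) {a b : ℝ} (ha : 0 < a) (hb : 0 < b) (hab : a + b = 1) :
    a * mutInfo P W + b * mutInfo R W ≤ mutInfo (fun x => a * P x + b * R x) W := by
  set M : 𝒳 → ℝ := fun x => a * P x + b * R x with hM
  have hMd : IsDist M := hP.mix hR ha.le hb.le hab
  have hsplit : ∀ x y, outDist M W y = 0 → P x * W x y = 0 ∧ R x * W x y = 0 := by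
    intro x y h
    have h0 := mul_eq_zero_of_outDist_eq_zero hMd.1 hW h x
    have h1 := mul_nonneg (hP.1 x) (hW x y)
    have h2 := mul_nonneg (hR.1 x) (hW x y)
    have h3 : a * (P x * W x y) + b * (R x * W x y) = 0 := by rw [← h0, hM]; ring
    have h4 := mul_nonneg ha.le h1
    have h5 := mul_nonneg hb.le h2
    exact ⟨(mul_eq_zero.1 (by linarith : a * (P x * W x y) = 0)).resolve_left ha.ne',
      (mul_eq_zero.1 (by linarith : b * (R x * W x y) = 0)).resolve_left hb.ne'⟩
  have hq := outDist_nonneg hMd.1 hW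
  have hqs := sum_outDist hMd hWsum
  have e1 := mutInfo_le_sum_relEnt hP hW hWsum hq hqs fun x y h => (hsplit x y h).1
  have e2 := mutInfo_le_sum_relEnt hR hW hWsum hq hqs fun x y h => (hsplit x y h).2
  have e3 : mutInfo M W = a * ∑ x, P x * relEnt (W x) (outDist M W)
      + b * ∑ x, R x * relEnt (W x) (outDist M W) := by
    rw [mutInfo_eq_sum_relEnt, Finset.mul_sum, Finset.mul_sum, ← Finset.sum_add_distrib]
    refine Finset.sum_congr rfl fun x _ => ?_
    simp only [hM]
    ring
  rw [e3]
  gcongr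

/-- If `P` is max-min optimal for `V` and `W` and some input beats the optimal value on `W`, then
`V` does not exceed `W` at `P`: otherwise mixing `P` with that input would improve both. -/
theorem mutInfo_le_mutInfo_of_maxmin {V : 𝒳 → 𝒴 → ℝ}
    (hV : ∀ x y, 0 ≤ V x y) (hVsum : ∀ x, ∑ y, V x y = 1)
    (hW : ∀ x y, 0 ≤ W x y) (hWsum : ∀ x, ∑ y, W x y = 1)
    (hP : IsDist P) (hR : IsDist R)
    (hmax : ∀ Q, IsDist Q →
      min (mutInfo Q V) (mutInfo Q W) ≤ min (mutInfo P V) (mutInfo P W))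
    (hgt : min (mutInfo P V) (mutInfo P W) < mutInfo R W) :
    mutInfo P V ≤ mutInfo P W := by
  by_contra! hlt
  rw [min_eq_right hlt.le] at hmax hgt
  set u := mutInfo P V - mutInfo P W with hu
  set s := |mutInfo R V - mutInfo P W| + 1 with hs
  have hu0 : 0 < u := sub_pos.2 hlt
  have hs0 : 0 < s := by positivity
  have habs := neg_abs_le (mutInfo R V - mutInfo P W)
  have ha : 0 < s / (u + s) := by positivity
  have hb : 0 < u / (u + s) := by positivity
  have hab : s / (u + s) + u / (u + s) = 1 := by field_simp; ring
  have hVm := mutInfo_mix_ge hP hR hV hVsum ha hb hab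
  have hWm := mutInfo_mix_ge hP hR hW hWsum ha hb hab
  have hm := hmax _ (hP.mix hR ha.le hb.le hab)
  have hVgt : mutInfo P W < s / (u + s) * mutInfo P V + u / (u + s) * mutInfo R V := by
    have : s / (u + s) * mutInfo P V + u / (u + s) * mutInfo R V - mutInfo P W
        = u / (u + s) * (s + (mutInfo R V - mutInfo P W)) := by
      have hPV : mutInfo P V = u + mutInfo P W := by rw [hu]; ring
      rw [hPV]
      field_simp
      ring
    have : 0 < u / (u + s) * (s + (mutInfo R V - mutInfo P W)) :=
      mul_pos hb (by linarith)
    linarith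
  have hWgt : mutInfo P W < s / (u + s) * mutInfo P W + u / (u + s) * mutInfo R W := by
    have := mul_pos hb (sub_pos.2 hgt)
    have h1 : s / (u + s) = 1 - u / (u + s) := by linarith
    rw [h1]
    linarith
  exact (lt_min (hVgt.trans_le hVm) (hWgt.trans_le hWm)).not_ge hm

theorem gradI_sub (Q P : 𝒳 → ℝ) (W : 𝒳 → 𝒴 → ℝ) :
    gradI P W (fun x => Q x - P x)
      = ∑ x, Q x * relEnt (W x) (outDist P W) - mutInfo P W := by
  simp only [gradI, mutInfo_eq_sum_relEnt, sub_mul, Finset.sum_sub_distrib]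

theorem relEnt_outDist_nonneg (hP : IsDist P) (hPpos : ∀ x, 0 < P x)
    (hW : ∀ x y, 0 ≤ W x y) (hWsum : ∀ x, ∑ y, W x y = 1) (x : 𝒳) :
    0 ≤ relEnt (W x) (outDist P W) :=
  relEnt_nonneg (hW x) (outDist_nonneg hP.1 hW)
    (fun _ hy => (mul_eq_zero.1 (mul_eq_zero_of_outDist_eq_zero hP.1 hW hy x)).resolve_left
      (hPpos x).ne')
    ((sum_outDist hP hWsum).trans (hWsum x).symm).le

/-- If a convex combination of the gradients at `P` vanishes, the weighted mutual information of
any input is at most the combined mutual information at `P`. -/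
theorem mul_mutInfo_le_of_gradI {V : 𝒳 → 𝒴 → ℝ}
    (hV : ∀ x y, 0 ≤ V x y) (hVsum : ∀ x, ∑ y, V x y = 1)
    (hW : ∀ x y, 0 ≤ W x y) (hWsum : ∀ x, ∑ y, W x y = 1)
    (hP : IsDist P) (hPpos : ∀ x, 0 < P x) (hR : IsDist R) {a b : ℝ} (ha : 0 ≤ a) (hb : 0 ≤ b)
    (hgrad : ∀ v : 𝒳 → ℝ, ∑ x, v x = 0 → a * gradI P V v + b * gradI P W v = 0) :
    a * mutInfo R V ≤ a * mutInfo P V + b * mutInfo P W := by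
  have h := hgrad (fun x => R x - P x) (by rw [Finset.sum_sub_distrib, hR.2, hP.2, sub_self])
  rw [gradI_sub, gradI_sub] at h
  have h1 : mutInfo R V ≤ ∑ x, R x * relEnt (V x) (outDist P V) :=
    mutInfo_le_sum_relEnt hR hV hVsum (outDist_nonneg hP.1 hV) (sum_outDist hP hVsum)
      fun x y hy => by
        rw [(mul_eq_zero.1 (mul_eq_zero_of_outDist_eq_zero hP.1 hV hy x)).resolve_left
          (hPpos x).ne', mul_zero]
  have h2 : 0 ≤ ∑ x, R x * relEnt (W x) (outDist P W) :=
    Finset.sum_nonneg fun x _ =>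
      mul_nonneg (hR.1 x) (relEnt_outDist_nonneg hP hPpos hW hWsum x)
  have h3 := mul_le_mul_of_nonneg_left h1 ha
  have h4 := mul_nonneg hb h2
  linarith

end ChannelInequalities

/-- `η·C₁ ≤ C` and `(1-η)·C₂ ≤ C`. -/
theorem eta_weighted_component_capacities_le_capacity
    (W1 W2 : 𝒳 → 𝒴 → ℝ)
    (hW1 : ∀ x y, 0 ≤ W1 x y) (hW1sum : ∀ x, ∑ y, W1 x y = 1)
    (hW2 : ∀ x y, 0 ≤ W2 x y) (hW2sum : ∀ x, ∑ y, W2 x y = 1)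
    (Pstar : 𝒳 → ℝ) (C C1 C2 : ℝ)
    (hPstar : IsDist Pstar) (hPpos : ∀ x, 0 < Pstar x)
    (hCach : min (mutInfo Pstar W1) (mutInfo Pstar W2) = C)
    (hCmax : ∀ P, IsDist P → min (mutInfo P W1) (mutInfo P W2) ≤ C)
    (hUniq : ∀ P, IsDist P → min (mutInfo P W1) (mutInfo P W2) = C → P = Pstar)
    (hC1 : IsLUB {r | ∃ P, IsDist P ∧ r = mutInfo P W1} C1)
    (hC2 : IsLUB {r | ∃ P, IsDist P ∧ r = mutInfo P W2} C2)
    (hC1gt : C < C1) (hC2gt : C < C2)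
    (η : ℝ) (hη : η ∈ Set.Ioo (0 : ℝ) 1)
    (hηeq : ∀ v : 𝒳 → ℝ, ∑ x, v x = 0 →
      η * gradI Pstar W1 v + (1 - η) * gradI Pstar W2 v = 0)
    :
    η * C1 ≤ C ∧ (1 - η) * C2 ≤ C := by
  subst hCach
  obtain ⟨_, ⟨R1, hR1, rfl⟩, hgt1, -⟩ := hC1.exists_between hC1gt
  obtain ⟨_, ⟨R2, hR2, rfl⟩, hgt2, -⟩ := hC2.exists_between hC2gt
  have heq : mutInfo Pstar W1 = mutInfo Pstar W2 := by
    refine le_antisymm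
      (mutInfo_le_mutInfo_of_maxmin hW1 hW1sum hW2 hW2sum hPstar hR2 hCmax hgt2)
      (mutInfo_le_mutInfo_of_maxmin hW2 hW2sum hW1 hW1sum hPstar hR1 ?_ ?_)
    · intro Q hQ
      rw [min_comm, min_comm (mutInfo Pstar W2)]
      exact hCmax Q hQ
    · rwa [min_comm]
  have hη1 : 0 < 1 - η := sub_pos.2 hη.2
  rw [heq, min_self]
  constructor
  · rw [← le_div_iff₀' hη.1]
    refine hC1.2 ?_
    rintro _ ⟨R, hR, rfl⟩
    rw [le_div_iff₀' hη.1]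
    have := mul_mutInfo_le_of_gradI hW1 hW1sum hW2 hW2sum hPstar hPpos hR hη.1.le hη1.le hηeq
    rw [heq] at this
    linarith
  · rw [← le_div_iff₀' hη1]
    refine hC2.2 ?_
    rintro _ ⟨R, hR, rfl⟩
    rw [le_div_iff₀' hη1]
    have := mul_mutInfo_le_of_gradI hW2 hW2sum hW1 hW1sum hPstar hPpos hR hη1.le hη.1.le
      fun v hv => (add_comm _ _).trans (hηeq v hv)
    rw [heq] at this
    linarith
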